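/- Let n ≥ 3 and consider the second-order scalar operator 𝔹 acting on u : ℝⁿ → ℝ given by 𝔹u = ( ∂₁²u + ∂₂²u, ∂₃²u, …, ∂ₙ²u ) with values in ℝ^{n−1}. Then: (i) 𝔹 is elliptic, i.e. its symbol 𝔹[ξ] = (ξ₁²+ξ₂², ξ₃², …, ξₙ²) is injective on ℝ for every ξ ∈ ℝⁿ\{0}; (ii) 𝔹 is cancelling, i.e. ⋂_{ξ ∈ ℝⁿ\{0}} 𝔹[ξ](ℝ) = {0}; and (iii) the space { u ∈ C^∞(ℝⁿ, ℝ) : 𝔹u = 0 } is infinite-dimensional. -/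

import Mathlib

noncomputable section

open MeasureTheory Metric

/-- Euclidean space `ℝⁿ`. -/
abbrev Euc (n : ℕ) : Type := EuclideanSpace ℝ (Fin n)

/-- The symbol `𝔹[ξ] v = v • (ξ₁² + ξ₂², ξ₃², …, ξₙ²)` of the second-order scalar
operator `𝔹`, with values in `ℝ^{n-1}` (zero-based indexing). -/
def Bsymb (n : ℕ) (hn : 3 ≤ n) (ξ : Euc n) (v : ℝ) : Fin (n - 1) → ℝ :=
  fun m =>
    if m.1 = 0 then v * (ξ ⟨0, by omega⟩ ^ 2 + ξ ⟨1, by omega⟩ ^ 2)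
    else v * ξ ⟨m.1 + 1, by have := m.isLt; omega⟩ ^ 2

/-- The operator `𝔹 u = (∂₁²u + ∂₂²u, ∂₃²u, …, ∂ₙ²u)` (zero-based indexing). -/
def Bop (n : ℕ) (hn : 3 ≤ n) (u : Euc n → ℝ) (x : Euc n) : Fin (n - 1) → ℝ :=
  fun m =>
    if m.1 = 0 then
      iteratedFDeriv ℝ 2 u x (fun _ => EuclideanSpace.single ⟨0, by omega⟩ 1)
        + iteratedFDeriv ℝ 2 u x (fun _ => EuclideanSpace.single ⟨1, by omega⟩ 1)
    else iteratedFDeriv ℝ 2 u x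
      (fun _ => EuclideanSpace.single ⟨m.1 + 1, by have := m.isLt; omega⟩ 1)

/-- The projection `x ↦ x₁ + i x₂`. -/
def projC (n : ℕ) (hn : 3 ≤ n) : Euc n →L[ℝ] ℂ :=
  (EuclideanSpace.proj (𝕜 := ℝ) (⟨0, by omega⟩ : Fin n)).smulRight (1 : ℂ)
    + (EuclideanSpace.proj (𝕜 := ℝ) (⟨1, by omega⟩ : Fin n)).smulRight Complex.I

/-- Real part of a complex polynomial composed with a linear map. -/
def rePoly {E : Type*} [NormedAddCommGroup E] [NormedSpace ℝ E] (L : E →L[ℝ] ℂ)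
    (q : Polynomial ℂ) (y : E) : ℝ := (q.eval (L y)).re

lemma rePoly_contDiff {E : Type*} [NormedAddCommGroup E] [NormedSpace ℝ E] (L : E →L[ℝ] ℂ)
    (q : Polynomial ℂ) (k : WithTop ℕ∞) : ContDiff ℝ k (rePoly L q) := by
  have h1 : ContDiff ℂ k (fun z : ℂ => q.eval z) := by
    simpa using q.contDiff_aeval (𝕜 := ℂ) (R := ℂ) k
  exact Complex.reCLM.contDiff.comp ((h1.restrict_scalars ℝ).comp L.contDiff)

lemma rePoly_fderiv {E : Type*} [NormedAddCommGroup E] [NormedSpace ℝ E] (L : E →L[ℝ] ℂ)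
    (q : Polynomial ℂ) (y w : E) :
    fderiv ℝ (rePoly L q) y w = rePoly L (Polynomial.C (L w) * q.derivative) y := by
  have h1 := ((q.hasDerivAt (L y)).hasFDerivAt.restrictScalars ℝ).comp y L.hasFDerivAt
  have h2 := (Complex.reCLM.hasFDerivAt (x := q.eval (L y))).comp y h1
  have h3 : HasFDerivAt (rePoly L q) _ y := h2
  rw [h3.fderiv]
  simp [rePoly]

lemma rePoly_second {E : Type*} [NormedAddCommGroup E] [NormedSpace ℝ E] (L : E →L[ℝ] ℂ)
    (q : Polynomial ℂ) (y w : E) :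
    iteratedFDeriv ℝ 2 (rePoly L q) y (fun _ => w)
      = (L w ^ 2 * q.derivative.derivative.eval (L y)).re := by
  rw [iteratedFDeriv_two_apply]
  have hd : DifferentiableAt ℝ (fderiv ℝ (rePoly L q)) y :=
    ((rePoly_contDiff L q 2).fderiv_right (m := 1) (by norm_num)).differentiable (by norm_num) y
  have h : fderiv ℝ (fun z => fderiv ℝ (rePoly L q) z w) y w
      = fderiv ℝ (fderiv ℝ (rePoly L q)) y w w := by
    rw [fderiv_clm_apply hd (differentiableAt_const w)]
    simp
  rw [← h]
  have h' : (fun z => fderiv ℝ (rePoly L q) z w)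
      = rePoly L (Polynomial.C (L w) * q.derivative) := funext fun z => rePoly_fderiv L q z w
  rw [h', rePoly_fderiv]
  simp [rePoly, pow_two, mul_assoc]

/-- The linear map sending a real polynomial `p` to `x ↦ Re p(x₁ + i x₂)`. -/
def polyMap (n : ℕ) (hn : 3 ≤ n) : Polynomial ℝ →ₗ[ℝ] (Euc n → ℝ) where
  toFun p := rePoly (projC n hn) (p.map (algebraMap ℝ ℂ))
  map_add' p q := by ext y; simp [rePoly]
  map_smul' c p := by ext y; simp [rePoly, Polynomial.map_smul]

lemma polyMap_injective (n : ℕ) (hn : 3 ≤ n) : Function.Injective (polyMap n hn) := by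
  intro p q h
  refine Polynomial.funext fun t => ?_
  have := congrFun h (EuclideanSpace.single ⟨0, by omega⟩ t)
  have hL : projC n hn (EuclideanSpace.single ⟨0, by omega⟩ t) = algebraMap ℝ ℂ t := by
    simp [projC]
  simp only [polyMap, LinearMap.coe_mk, AddHom.coe_mk, rePoly, hL, Polynomial.eval_map_algebraMap,
    Polynomial.aeval_algebraMap_apply] at this
  simpa using this

lemma polyMap_mem (n : ℕ) (hn : 3 ≤ n) (p : Polynomial ℝ) :
    ContDiff ℝ (⊤ : ℕ∞) (polyMap n hn p) ∧ ∀ x, Bop n hn (polyMap n hn p) x = 0 := by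
  refine ⟨rePoly_contDiff _ _ _, fun x => ?_⟩
  have e : polyMap n hn p = rePoly (projC n hn) (p.map (algebraMap ℝ ℂ)) := rfl
  ext m
  simp only [Bop, e, rePoly_second]
  have h0 : projC n hn (EuclideanSpace.single ⟨0, by omega⟩ 1) = 1 := by simp [projC]
  have h1 : projC n hn (EuclideanSpace.single ⟨1, by omega⟩ 1) = Complex.I := by simp [projC]
  split_ifs with hm
  · rw [h0, h1]; simp
  · have h2 : projC n hn (EuclideanSpace.single ⟨m.1 + 1, by have := m.isLt; omega⟩ 1) = 0 := by
      simp [projC, hm, Ne.symm hm]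
    rw [h2]; simp

/-- For `n ≥ 3`, the second-order scalar operator
`𝔹u = (∂₁²u + ∂₂²u, ∂₃²u, …, ∂ₙ²u)` is (i) elliptic, (ii) cancelling, and (iii) has
infinite-dimensional null-space. -/
theorem statement8 (n : ℕ) (hn : 3 ≤ n) :
    (∀ ξ : Euc n, ξ ≠ 0 → Function.Injective (Bsymb n hn ξ)) ∧
    (⋂ ξ ∈ {ξ : Euc n | ξ ≠ 0}, Set.range (Bsymb n hn ξ)) = {0} ∧
    ¬ FiniteDimensional ℝ ↥(Submodule.span ℝ
        {u : Euc n → ℝ | ContDiff ℝ (⊤ : ℕ∞) u ∧ ∀ x, Bop n hn u x = 0}) := by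
  refine ⟨?_, ?_, ?_⟩
  · intro ξ hξ v w h
    by_contra hvw
    apply hξ
    have key : ∀ a : ℝ, v * a = w * a → a = 0 := fun a ha => by
      by_contra h0
      exact hvw (mul_right_cancel₀ h0 ha)
    have h01 := key _ (by simpa [Bsymb] using congrFun h ⟨0, by omega⟩)
    ext ⟨i, hi⟩
    show ξ ⟨i, hi⟩ = 0
    rcases i with _ | _ | i
    · show ξ ⟨0, by omega⟩ = 0
      nlinarith [sq_nonneg (ξ ⟨0, by omega⟩), sq_nonneg (ξ ⟨1, by omega⟩)]
    · show ξ ⟨1, by omega⟩ = 0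
      nlinarith [sq_nonneg (ξ ⟨0, by omega⟩), sq_nonneg (ξ ⟨1, by omega⟩)]
    · have h2 := congrFun h ⟨i + 1, by omega⟩
      simp only [Bsymb, Nat.succ_ne_zero, if_false] at h2
      exact pow_eq_zero_iff (two_ne_zero) |>.1 (key _ h2)
  · ext f
    simp only [Set.mem_iInter, Set.mem_setOf_eq, Set.mem_range, Set.mem_singleton_iff]
    constructor
    · intro h
      obtain ⟨v, hv⟩ := h (EuclideanSpace.single ⟨0, by omega⟩ 1) (by simp)
      obtain ⟨w, hw⟩ := h (EuclideanSpace.single ⟨2, by omega⟩ 1) (by simp)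
      ext m
      by_cases hm : m.1 = 0
      · rw [← hw]; simp [Bsymb, hm]
      · rw [← hv]; simp [Bsymb, hm]
    · rintro rfl ξ _
      exact ⟨0, by ext m; simp [Bsymb]⟩
  · intro hfin
    let S := Submodule.span ℝ
        {u : Euc n → ℝ | ContDiff ℝ (⊤ : ℕ∞) u ∧ ∀ x, Bop n hn u x = 0}
    have : FiniteDimensional ℝ S := hfin
    let g : Polynomial ℝ →ₗ[ℝ] S := (polyMap n hn).codRestrict S
      fun p => Submodule.subset_span (polyMap_mem n hn p)
    have hg : Function.Injective g := fun p q h =>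
      polyMap_injective n hn (congrArg Subtype.val h)
    exact Polynomial.not_finite (Module.Finite.of_injective g hg)
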